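/- arXiv:0803.0782 — 3 statements merged into one kernel-verified Lean document; each statement's English description precedes it below -/
import Mathlib

section
/- For n ≥ 2, let (i,j) and (k,l) be pairs of distinct elements of {1,...,n} with j - i = l - k. Then the permutations σ_{ij} and σ_{kl} are comparable in the Bruhat order on S_n: either σ_{ij} ≤ σ_{kl} or σ_{kl} ≤ σ_{ij}. -/
/-- `sigmaSpec n hn i j σ` says that `σ` is the permutation of `Fin n` (representing
`{1,...,n}`) whose one-line notation lists the elements of `{1,...,n} \ {i,j}` in
decreasing order in the first `n-2` positions, followed by `i` and then `j`. -/
def sigmaSpec (n : ℕ) (hn : 2 ≤ n) (i j : Fin n) (σ : Equiv.Perm (Fin n)) : Prop :=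
  σ ⟨n - 2, by omega⟩ = i ∧ σ ⟨n - 1, by omega⟩ = j ∧
    ∀ p q : Fin n, p < q → (q : ℕ) < n - 2 → σ q < σ p

/-- The number of inversions of a permutation of `Fin n`. -/
def inversions {n : ℕ} (u : Equiv.Perm (Fin n)) : ℕ :=
  (Finset.univ.filter fun p : Fin n × Fin n => p.1 < p.2 ∧ u p.2 < u p.1).card

/-- Bruhat order: `u ≤ w` iff there is a chain from `u` to `w`, each step multiplying by a
transposition and strictly increasing the number of inversions. -/
def bruhatLE {n : ℕ} (u w : Equiv.Perm (Fin n)) : Prop :=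
  Relation.ReflTransGen
    (fun x y => (∃ t : Equiv.Perm (Fin n), t.IsSwap ∧ y = x * t) ∧
      inversions x < inversions y) u w

theorem swap_lt_swap_of_lt {n : ℕ} {a b x y : Fin n} (hab : (b : ℕ) = a + 1) (hxy : x < y)
    (h : ¬(x = a ∧ y = b)) : Equiv.swap a b x < Equiv.swap a b y := by
  simp only [Equiv.swap_apply_def]
  simp only [Fin.ext_iff, Fin.lt_def] at *
  split_ifs <;> omega

/-- Exchanging the adjacent values `a` and `a + 1` of `σ` creates an inversion when `a` occurs
to the left of `a + 1`. -/
theorem inversions_lt_inversions_swap_mul {n : ℕ} {a b p q : Fin n} {σ : Equiv.Perm (Fin n)}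
    (hab : (b : ℕ) = a + 1) (hpq : p < q) (hp : σ p = a) (hq : σ q = b) :
    inversions σ < inversions (Equiv.swap a b * σ) := by
  have hlt : a < b := by rw [Fin.lt_def]; omega
  apply Finset.card_lt_card
  rw [Finset.ssubset_iff_of_subset]
  · refine ⟨(p, q), ?_, ?_⟩
    · rw [Finset.mem_filter]
      simp [hpq, hp, hq, hlt]
    · rw [Finset.mem_filter]
      simp [hp, hq, hlt.le]
  · rintro ⟨x, y⟩ hxy
    rw [Finset.mem_filter] at hxy ⊢
    replace hxy := hxy.2
    refine ⟨Finset.mem_univ _, hxy.1, swap_lt_swap_of_lt hab hxy.2 ?_⟩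
    rintro ⟨hy, hx⟩
    rw [← hp, σ.injective.eq_iff] at hy
    rw [← hq, σ.injective.eq_iff] at hx
    subst hy hx
    exact lt_asymm hpq hxy.1

theorem bruhatLE_swap_mul {n : ℕ} {a b p q : Fin n} {σ : Equiv.Perm (Fin n)}
    (hab : (b : ℕ) = a + 1) (hpq : p < q) (hp : σ p = a) (hq : σ q = b) :
    bruhatLE σ (Equiv.swap a b * σ) := by
  refine Relation.ReflTransGen.single
    ⟨⟨Equiv.swap p q, ⟨p, q, hpq.ne, rfl⟩, ?_⟩, inversions_lt_inversions_swap_mul hab hpq hp hq⟩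
  rw [← hp, ← hq, Equiv.mul_swap_eq_swap_mul]

namespace sigmaSpec

variable {n : ℕ} {hn : 2 ≤ n} {i j : Fin n} {σ τ : Equiv.Perm (Fin n)}

theorem lt_of_apply_ne (h : sigmaSpec n hn i j σ) {p : Fin n} (hi : σ p ≠ i) (hj : σ p ≠ j) :
    (p : ℕ) < n - 2 := by
  by_contra hp
  obtain hp | hp : (p : ℕ) = n - 2 ∨ (p : ℕ) = n - 1 := by omega
  · exact hi (by rw [← h.1]; congr 1; exact Fin.ext hp)
  · exact hj (by rw [← h.2.1]; congr 1; exact Fin.ext hp)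

theorem apply_ne (h : sigmaSpec n hn i j σ) {p : Fin n} (hp : (p : ℕ) < n - 2) :
    σ p ≠ i ∧ σ p ≠ j := by
  rw [← h.1, ← h.2.1, Ne, Ne, σ.injective.eq_iff, σ.injective.eq_iff, Fin.ext_iff, Fin.ext_iff]
  dsimp only
  omega

theorem unique (hσ : sigmaSpec n hn i j σ) (hτ : sigmaSpec n hn i j τ) : σ = τ := by
  have hlast : ∀ p : Fin n, ¬(p : ℕ) < n - 2 → τ⁻¹ (σ p) = p := by
    intro p hp
    rw [Equiv.Perm.inv_eq_iff_eq]
    obtain hp | hp : (p : ℕ) = n - 2 ∨ (p : ℕ) = n - 1 := by omega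
    · have hp' : p = ⟨n - 2, by omega⟩ := Fin.ext hp
      rw [hp', hσ.1, hτ.1]
    · have hp' : p = ⟨n - 1, by omega⟩ := Fin.ext hp
      rw [hp', hσ.2.1, hτ.2.1]
  have hfirst : ∀ p : Fin n, (p : ℕ) < n - 2 → ((τ⁻¹ (σ p) : Fin n) : ℕ) < n - 2 := by
    intro p hp
    apply hτ.lt_of_apply_ne <;> simp [hσ.apply_ne hp]
  have hmono : StrictMono (τ⁻¹ * σ) := by
    intro p q hpq
    simp only [Equiv.Perm.coe_mul, Function.comp_apply]
    by_cases hq : (q : ℕ) < n - 2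
    · have hp : (p : ℕ) < n - 2 := lt_trans hpq hq
      by_contra! hle
      have hσpq := hσ.2.2 p q hpq hq
      rcases hle.lt_or_eq with hlt | heq
      · have := hτ.2.2 _ _ hlt (hfirst p hp)
        simp at this
        exact lt_asymm this hσpq
      · exact hσpq.ne (τ⁻¹.injective heq)
    · rw [hlast q hq]
      by_cases hp : (p : ℕ) < n - 2
      · have := hfirst p hp
        rw [Fin.lt_def]
        omega
      · rwa [hlast p hp]
  have hid : ⇑(τ⁻¹ * σ) = id :=
    (hmono.range_inj strictMono_id).1 (by simp [(τ⁻¹ * σ).surjective.range_eq, -Equiv.Perm.coe_mul])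
  have : τ⁻¹ * σ = 1 := Equiv.ext fun p => congrFun hid p
  exact (inv_mul_eq_one.mp this).symm

/-- Lowering one of the two final values of `σ` by one moves up in the Bruhat order. -/
theorem swap_mul (h : sigmaSpec n hn i j σ) {a b : Fin n} (hab : (b : ℕ) = a + 1)
    (hb : b = i ∨ b = j) (hi : a ≠ i) (hj : a ≠ j) :
    sigmaSpec n hn (Equiv.swap a b i) (Equiv.swap a b j) (Equiv.swap a b * σ) ∧
      bruhatLE σ (Equiv.swap a b * σ) := by
  refine ⟨⟨by simp [h.1], by simp [h.2.1], ?_⟩, ?_⟩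
  · intro p q hpq hq
    refine swap_lt_swap_of_lt hab (h.2.2 p q hpq hq) ?_
    rintro ⟨-, hp⟩
    have := h.apply_ne (p := p) (lt_trans hpq hq)
    rcases hb with rfl | rfl
    · exact this.1 hp
    · exact this.2 hp
  · have ha : ((σ⁻¹ a : Fin n) : ℕ) < n - 2 := by
      apply h.lt_of_apply_ne <;> simpa
    have hb' : n - 2 ≤ ((σ⁻¹ b : Fin n) : ℕ) := by
      by_contra! hlt
      have := h.apply_ne hlt
      simp at this
      tauto
    exact bruhatLE_swap_mul hab (p := σ⁻¹ a) (q := σ⁻¹ b) (by rw [Fin.lt_def]; omega)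
      (by simp) (by simp)

/-- Lowering both final values of `σ` by one moves up in the Bruhat order. -/
theorem exists_pred (h : sigmaSpec n hn i j σ) (hij : i ≠ j) {a b : Fin n}
    (ha : (i : ℕ) = a + 1) (hb : (j : ℕ) = b + 1) :
    ∃ τ, sigmaSpec n hn a b τ ∧ bruhatLE σ τ := by
  have hai : a ≠ i := by rw [Ne, Fin.ext_iff]; omega
  have hbj : b ≠ j := by rw [Ne, Fin.ext_iff]; omega
  have hab : a ≠ b := by rw [Ne, Fin.ext_iff] at hij ⊢; omega
  by_cases haj : a = j
  · have hbi : b ≠ i := by rw [Fin.ext_iff] at haj; rw [Ne, Fin.ext_iff]; omega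
    obtain ⟨h₁, hle₁⟩ := h.swap_mul hb (.inr rfl) hbi hbj
    rw [Equiv.swap_apply_right, Equiv.swap_apply_of_ne_of_ne hbi.symm hij] at h₁
    obtain ⟨h₂, hle₂⟩ := h₁.swap_mul ha (.inl rfl) hai hab
    rw [Equiv.swap_apply_right, Equiv.swap_apply_of_ne_of_ne hab.symm hbi] at h₂
    exact ⟨_, h₂, hle₁.trans hle₂⟩
  · obtain ⟨h₁, hle₁⟩ := h.swap_mul ha (.inl rfl) hai haj
    rw [Equiv.swap_apply_right, Equiv.swap_apply_of_ne_of_ne (Ne.symm haj) hij.symm] at h₁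
    obtain ⟨h₂, hle₂⟩ := h₁.swap_mul hb (.inr rfl) hab.symm hbj
    rw [Equiv.swap_apply_right, Equiv.swap_apply_of_ne_of_ne hab haj] at h₂
    exact ⟨_, h₂, hle₁.trans hle₂⟩

theorem bruhatLE_of_add (m : ℕ) {k l : Fin n} (hkl : k ≠ l) (hk : (k : ℕ) = i + m)
    (hl : (l : ℕ) = j + m) (hσ : sigmaSpec n hn k l σ) (hτ : sigmaSpec n hn i j τ) :
    bruhatLE σ τ := by
  induction m generalizing k l σ with
  | zero =>
    obtain rfl : k = i := Fin.ext hk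
    obtain rfl : l = j := Fin.ext hl
    rw [hσ.unique hτ]
    exact Relation.ReflTransGen.refl
  | succ m ih =>
    obtain ⟨ρ, hρ, hle⟩ := hσ.exists_pred hkl (a := ⟨i + m, by omega⟩) (b := ⟨j + m, by omega⟩)
      (by simp only; omega) (by simp only; omega)
    refine hle.trans (ih ?_ rfl rfl hρ)
    rw [Ne, Fin.ext_iff] at hkl ⊢
    simp only
    omega

end sigmaSpec

theorem bruhat_comparable_of_equal_height (n : ℕ) (hn : 2 ≤ n)
    (i j k l : Fin n) (hij : i ≠ j) (hkl : k ≠ l)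
    (hht : (j : ℤ) - (i : ℤ) = (l : ℤ) - (k : ℤ))
    (σ₁ σ₂ : Equiv.Perm (Fin n))
    (h₁ : sigmaSpec n hn i j σ₁) (h₂ : sigmaSpec n hn k l σ₂) :
    bruhatLE σ₁ σ₂ ∨ bruhatLE σ₂ σ₁ := by
  rcases le_total (i : ℕ) k with h | h
  · exact .inr (h₂.bruhatLE_of_add (k - i : ℕ) hkl (by omega) (by omega) h₁)
  · exact .inl (h₁.bruhatLE_of_add (i - k : ℕ) hij (by omega) (by omega) h₂)
end

section
/- For n ≥ 2 and distinct i, j ∈ {2,...,n}, the number of inversions of σ_{i-1,j-1} equals the number of inversions of σ_{ij} plus 2, and there exist a permutation τ ∈ S_n and transpositions t_1, t_2 ∈ S_n such that τ = σ_{ij}·t_1, σ_{i-1,j-1} = τ·t_2, the number of inversions of τ is one more than that of σ_{ij}, and the number of inversions of σ_{i-1,j-1} is one more than that of τ. In particular σ_{ij} < σ_{i-1,j-1} in the Bruhat order. -/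
/-- Exchanging the values `a` and `a + 1` of a permutation in which `a` stands to the left
of `a + 1` adds exactly one inversion. -/
theorem inversions_swap_mul_of_symm_lt {n : ℕ} (u : Equiv.Perm (Fin n)) (a b : Fin n)
    (hab : (a : ℕ) + 1 = b) (h : u.symm a < u.symm b) :
    inversions (Equiv.swap a b * u) = inversions u + 1 := by
  have hset : (Finset.univ.filter fun p : Fin n × Fin n =>
        p.1 < p.2 ∧ (Equiv.swap a b * u) p.2 < (Equiv.swap a b * u) p.1) =
      insert (u.symm a, u.symm b)
        (Finset.univ.filter fun p : Fin n × Fin n => p.1 < p.2 ∧ u p.2 < u p.1) := by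
    ext ⟨x, y⟩
    obtain ⟨v, rfl⟩ := u.symm.surjective x
    obtain ⟨w, rfl⟩ := u.symm.surjective y
    rw [Finset.mem_insert, Finset.mem_filter, Finset.mem_filter]
    simp only [Finset.mem_univ, true_and, Prod.mk.injEq, Equiv.Perm.mul_apply,
      Equiv.apply_symm_apply, Equiv.apply_eq_iff_eq, Equiv.swap_apply_def]
    have hvw : u.symm v < u.symm w → v ≠ w := fun hlt heq => hlt.ne (congrArg _ heq)
    constructor
    · rintro ⟨hlt, hval⟩
      have := hvw hlt
      split_ifs at hval <;> grind
    · rintro (⟨rfl, rfl⟩ | ⟨hlt, hval⟩)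
      · refine ⟨h, ?_⟩
        split_ifs <;> grind
      · refine ⟨hlt, ?_⟩
        have : ¬ (v = b ∧ w = a) := by
          rintro ⟨rfl, rfl⟩
          exact lt_asymm h hlt
        split_ifs <;> grind
  unfold inversions
  rw [hset, Finset.card_insert_of_notMem]
  simp only [Finset.mem_filter, Equiv.apply_symm_apply, not_and, not_lt]
  intro _ _
  omega

/-- A permutation satisfying `sigmaSpec` takes values other than `i` and `j` exactly in the
first `n - 2` positions. -/
theorem sigmaSpec.val_lt_iff {n : ℕ} {hn : 2 ≤ n} {i j : Fin n} {σ : Equiv.Perm (Fin n)}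
    (h : sigmaSpec n hn i j σ) (p : Fin n) : (p : ℕ) < n - 2 ↔ σ p ≠ i ∧ σ p ≠ j := by
  rw [← h.1, ← h.2.1, σ.injective.ne_iff, σ.injective.ne_iff, Ne, Ne, Fin.ext_iff, Fin.ext_iff]
  dsimp only
  omega

/-- There is at most one permutation satisfying `sigmaSpec n hn i j`. -/
theorem sigmaSpec.unique_s1 {n : ℕ} {hn : 2 ≤ n} {i j : Fin n} {σ τ : Equiv.Perm (Fin n)}
    (hσ : sigmaSpec n hn i j σ) (hτ : sigmaSpec n hn i j τ) : σ = τ := by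
  have hrange : ∀ ρ : Equiv.Perm (Fin n), sigmaSpec n hn i j ρ →
      Set.range (fun k : Fin (n - 2) => ρ (k.castLE (Nat.sub_le n 2))) =
        {x | x ≠ i ∧ x ≠ j} := by
    intro ρ hρ
    ext x
    constructor
    · rintro ⟨k, rfl⟩
      exact (hρ.val_lt_iff _).1 k.2
    · intro hx
      have hlt := (hρ.val_lt_iff (ρ.symm x)).2 (by simpa using hx)
      exact ⟨⟨_, hlt⟩, by simp⟩
  have hanti : ∀ ρ : Equiv.Perm (Fin n), sigmaSpec n hn i j ρ →
      StrictAnti (fun k : Fin (n - 2) => ρ (k.castLE (Nat.sub_le n 2))) :=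
    fun ρ hρ k l hkl => hρ.2.2 _ _ hkl l.2
  have heq := ((hanti σ hσ).range_inj (hanti τ hτ)).1
    ((hrange σ hσ).trans (hrange τ hτ).symm)
  ext1 p
  by_cases hp : (p : ℕ) < n - 2
  · exact congrFun heq ⟨p, hp⟩
  · obtain hp | hp : p = ⟨n - 2, by omega⟩ ∨ p = ⟨n - 1, by omega⟩ := by
      simp only [Fin.ext_iff]
      omega
    · rw [hp, hσ.1, hτ.1]
    · rw [hp, hσ.2.1, hτ.2.1]

/-- Exchanging one of the last two values with its predecessor, when the latter is among the
first `n - 2` values, again yields a permutation of the same shape. -/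
theorem sigmaSpec.swap_mul_s1 {n : ℕ} {hn : 2 ≤ n} {i j a b : Fin n} {σ : Equiv.Perm (Fin n)}
    (h : sigmaSpec n hn i j σ) (hab : (a : ℕ) + 1 = b) (hb : b = i ∨ b = j) :
    sigmaSpec n hn (Equiv.swap a b i) (Equiv.swap a b j) (Equiv.swap a b * σ) := by
  refine ⟨by rw [Equiv.Perm.mul_apply, h.1], by rw [Equiv.Perm.mul_apply, h.2.1], ?_⟩
  intro p q hpq hq
  have hlt := h.2.2 p q hpq hq
  have hq' := (h.val_lt_iff q).1 hq
  have hp' := (h.val_lt_iff p).1 (lt_trans hpq hq)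
  simp only [Equiv.Perm.mul_apply, Equiv.swap_apply_def]
  split_ifs <;> grind

/-- Exchanging one of the last two values with its predecessor, when the latter is among the
first `n - 2` values, adds exactly one inversion. -/
theorem sigmaSpec.inversions_swap_mul {n : ℕ} {hn : 2 ≤ n} {i j a b : Fin n}
    {σ : Equiv.Perm (Fin n)} (h : sigmaSpec n hn i j σ) (hab : (a : ℕ) + 1 = b)
    (hb : b = i ∨ b = j) (hai : a ≠ i) (haj : a ≠ j) :
    inversions (Equiv.swap a b * σ) = inversions σ + 1 := by
  refine inversions_swap_mul_of_symm_lt σ a b hab ?_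
  have ha := (h.val_lt_iff (σ.symm a)).2 (by simpa using ⟨hai, haj⟩)
  have hb' := (h.val_lt_iff (σ.symm b)).not.2 (by simpa using fun hbi => hb.resolve_left hbi)
  rw [Fin.lt_def]
  omega

/-- Multiplying by a transposition of values on the left is multiplying by a transposition of
positions on the right. -/
theorem exists_isSwap_swap_mul_eq {α : Type*} [DecidableEq α] (u : Equiv.Perm α) {a b : α}
    (hab : a ≠ b) : ∃ t : Equiv.Perm α, t.IsSwap ∧ Equiv.swap a b * u = u * t :=
  ⟨Equiv.swap (u⁻¹ a) (u⁻¹ b), ⟨_, _, u⁻¹.injective.ne hab, rfl⟩,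
    Equiv.swap_mul_eq_mul_swap u a b⟩

/-- Two successive exchanges of one of the last two values with its predecessor form a chain of
two transpositions each adding one inversion. -/
theorem sigmaSpec.exists_chain {n : ℕ} {hn : 2 ≤ n} {i j k l a b c d : Fin n}
    {σ σ' : Equiv.Perm (Fin n)} (hσ : sigmaSpec n hn i j σ)
    (hab : (a : ℕ) + 1 = b) (hb : b = i ∨ b = j) (hai : a ≠ i) (haj : a ≠ j)
    (hk : Equiv.swap a b i = k) (hl : Equiv.swap a b j = l)
    (hcd : (c : ℕ) + 1 = d) (hd : d = k ∨ d = l) (hck : c ≠ k) (hcl : c ≠ l)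
    (hσ' : sigmaSpec n hn (Equiv.swap c d k) (Equiv.swap c d l) σ') :
    ∃ τ t₁ t₂ : Equiv.Perm (Fin n), t₁.IsSwap ∧ t₂.IsSwap ∧
      τ = σ * t₁ ∧ σ' = τ * t₂ ∧
      inversions τ = inversions σ + 1 ∧ inversions σ' = inversions τ + 1 := by
  have hτ := hσ.swap_mul_s1 hab hb
  rw [hk, hl] at hτ
  have hinv := hσ.inversions_swap_mul hab hb hai haj
  have hinv' := hτ.inversions_swap_mul hcd hd hck hcl
  obtain ⟨t₁, ht₁, h₁⟩ := exists_isSwap_swap_mul_eq σ (a := a) (b := b) (by grind)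
  obtain ⟨t₂, ht₂, h₂⟩ := exists_isSwap_swap_mul_eq (Equiv.swap a b * σ) (a := c) (b := d)
    (by grind)
  have heq := hσ'.unique_s1 (hτ.swap_mul_s1 hcd hd)
  exact ⟨_, t₁, t₂, ht₁, ht₂, h₁, heq.trans h₂, hinv, heq ▸ hinv'⟩

/-- For distinct `i, j ∈ {2,...,n}` (here: `i, j : Fin n` with `1 ≤ i, j`, and
`i' = i - 1`, `j' = j - 1`), the permutation `σ_{i-1,j-1}` has exactly two more
inversions than `σ_{ij}`, reached by two length-increasing transposition steps;
in particular `σ_{ij} < σ_{i-1,j-1}` in the Bruhat order. -/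
theorem sigma_pred_pair_covers (n : ℕ) (hn : 2 ≤ n) (i j i' j' : Fin n) (hij : i ≠ j)
    (hi : 1 ≤ (i : ℕ)) (hj : 1 ≤ (j : ℕ))
    (hi' : (i' : ℕ) = (i : ℕ) - 1) (hj' : (j' : ℕ) = (j : ℕ) - 1)
    (σ σ' : Equiv.Perm (Fin n))
    (hσ : sigmaSpec n hn i j σ) (hσ' : sigmaSpec n hn i' j' σ') :
    inversions σ' = inversions σ + 2 ∧
    (∃ τ t₁ t₂ : Equiv.Perm (Fin n), t₁.IsSwap ∧ t₂.IsSwap ∧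
      τ = σ * t₁ ∧ σ' = τ * t₂ ∧
      inversions τ = inversions σ + 1 ∧ inversions σ' = inversions τ + 1) ∧
    (bruhatLE σ σ' ∧ σ ≠ σ') := by
  have hchain : ∃ τ t₁ t₂ : Equiv.Perm (Fin n), t₁.IsSwap ∧ t₂.IsSwap ∧
      τ = σ * t₁ ∧ σ' = τ * t₂ ∧
      inversions τ = inversions σ + 1 ∧ inversions σ' = inversions τ + 1 := by
    have hi1 : (i' : ℕ) + 1 = i := by omega
    have hj1 : (j' : ℕ) + 1 = j := by omega
    have hii : i' ≠ i := by grind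
    have hjj : j' ≠ j := by grind
    have hij' : i' ≠ j' := by grind
    by_cases h : i' = j
    · have hji : j' ≠ i := by grind
      refine hσ.exists_chain hj1 (Or.inr rfl) hji hjj
        (Equiv.swap_apply_of_ne_of_ne hji.symm hij) (Equiv.swap_apply_right _ _)
        hi1 (Or.inl rfl) hii hij' ?_
      rwa [Equiv.swap_apply_right, Equiv.swap_apply_of_ne_of_ne hij'.symm hji]
    · refine hσ.exists_chain hi1 (Or.inl rfl) hii h
        (Equiv.swap_apply_right _ _) (Equiv.swap_apply_of_ne_of_ne (Ne.symm h) hij.symm)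
        hj1 (Or.inr rfl) hij'.symm hjj ?_
      rwa [Equiv.swap_apply_right, Equiv.swap_apply_of_ne_of_ne hij' h]
  refine ⟨?_, hchain, ?_, ?_⟩
  · obtain ⟨τ, t₁, t₂, -, -, -, -, h₁, h₂⟩ := hchain
    omega
  · obtain ⟨τ, t₁, t₂, ht₁, ht₂, hτ, hτ', h₁, h₂⟩ := hchain
    exact .tail (.single ⟨⟨t₁, ht₁, hτ⟩, by omega⟩) ⟨⟨t₂, ht₂, hτ'⟩, by omega⟩
  · rintro rfl
    obtain ⟨τ, t₁, t₂, -, -, -, -, h₁, h₂⟩ := hchain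
    omega
end

section
/- For n ≥ 2, let (i,j) and (k,l) be pairs of distinct elements of {1,...,n} with (i,j) ≠ (k,l). If the number of inversions of σ_{ij} equals the number of inversions of σ_{kl}, then j - i ≠ l - k (the corresponding roots have different heights). -/
/-- The number of inversions whose later position is `q`. -/
def inversionsAt {n : ℕ} (u : Equiv.Perm (Fin n)) (q : Fin n) : ℕ :=
  (Finset.univ.filter fun p : Fin n => p < q ∧ u q < u p).card

theorem inversions_eq_sum_inversionsAt {n : ℕ} (u : Equiv.Perm (Fin n)) :
    inversions u = ∑ q, inversionsAt u q := by
  simp only [inversions, inversionsAt, Finset.card_filter]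
  rw [Fintype.sum_prod_type, Finset.sum_comm]

theorem card_filter_lt_apply {n : ℕ} (u : Equiv.Perm (Fin n)) (a : Fin n) :
    (Finset.univ.filter fun p : Fin n => a < u p).card = n - 1 - a := by
  rw [← Fin.card_Ioi a, ← Finset.card_map u.toEmbedding]
  congr 1
  ext x
  simp only [Finset.mem_map_equiv, Finset.mem_filter, Finset.mem_univ, true_and,
    Equiv.apply_symm_apply, Finset.mem_Ioi]

theorem inversionsAt_of_forall_lt {n : ℕ} (u : Equiv.Perm (Fin n)) (q : Fin n)
    (h : ∀ p < q, u q < u p) : inversionsAt u q = q := by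
  rw [inversionsAt, ← Fin.card_Iio q]
  congr 1
  ext p
  simpa using h p

theorem inversionsAt_last {m : ℕ} (u : Equiv.Perm (Fin (m + 1))) :
    inversionsAt u (Fin.last m) = m - u (Fin.last m) := by
  have h := card_filter_lt_apply u (u (Fin.last m))
  rw [Nat.add_sub_cancel] at h
  rw [inversionsAt, ← h]
  congr 1
  ext p
  simp only [Finset.mem_filter, Finset.mem_univ, true_and, and_iff_right_iff_imp]
  intro hp
  exact Fin.lt_last_iff_ne_last.2 fun e => by simp [e] at hp

theorem inversionsAt_penultimate {m : ℕ} (u : Equiv.Perm (Fin (m + 2))) :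
    inversionsAt u (Fin.last m).castSucc +
        (if u (Fin.last m).castSucc < u (Fin.last (m + 1)) then 1 else 0) =
      m + 1 - u (Fin.last m).castSucc := by
  have h := card_filter_lt_apply u (u (Fin.last m).castSucc)
  rw [show m + 2 - 1 = m + 1 from rfl] at h
  rw [inversionsAt, ← h, Finset.card_filter, Finset.card_filter, Fin.sum_univ_castSucc,
    Fin.sum_univ_castSucc (n := m + 1)]
  have hlast : ¬ Fin.last (m + 1) < (Fin.last m).castSucc := by simp [Fin.lt_def]
  simp only [hlast, false_and, if_false, add_zero]
  congr 1
  refine Finset.sum_congr rfl fun p _ => ?_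
  congr 1
  simp only [Fin.castSucc_lt_castSucc_iff, eq_iff_iff, and_iff_right_iff_imp]
  intro hp
  exact Fin.lt_last_iff_ne_last.2 fun e => by simp [e] at hp

theorem inversions_add_of_sigmaSpec {m : ℕ} (hn : 2 ≤ m + 2) {i j : Fin (m + 2)}
    {σ : Equiv.Perm (Fin (m + 2))} (h : sigmaSpec (m + 2) hn i j σ) :
    inversions σ + i + j + (if i < j then 1 else 0) = ∑ q : Fin m, (q : ℕ) + 2 * (m + 1) := by
  obtain ⟨hi, hj, hdec⟩ := h
  replace hi : σ (Fin.last m).castSucc = i := hi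
  replace hj : σ (Fin.last (m + 1)) = j := hj
  have hpen := inversionsAt_penultimate σ
  have hlast := inversionsAt_last σ
  rw [hi, hj] at hpen
  rw [hj] at hlast
  have hinit : ∑ q : Fin m, inversionsAt σ q.castSucc.castSucc = ∑ q : Fin m, (q : ℕ) :=
    Finset.sum_congr rfl fun q _ =>
      inversionsAt_of_forall_lt σ _ fun p hp => hdec p _ hp q.isLt
  rw [inversions_eq_sum_inversionsAt, Fin.sum_univ_castSucc, Fin.sum_univ_castSucc, hinit]
  have := i.isLt
  have := j.isLt
  omega

/-- Distinct pairs whose permutations `σ_{ij}`, `σ_{kl}` have equal inversion number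
correspond to roots of different heights: `j - i ≠ l - k`. -/
theorem height_ne_of_equal_inversions (n : ℕ) (hn : 2 ≤ n)
    (i j k l : Fin n) (hij : i ≠ j) (hkl : k ≠ l) (hne : (i, j) ≠ (k, l))
    (σ₁ σ₂ : Equiv.Perm (Fin n))
    (h₁ : sigmaSpec n hn i j σ₁) (h₂ : sigmaSpec n hn k l σ₂)
    (hinv : inversions σ₁ = inversions σ₂) :
    (j : ℤ) - (i : ℤ) ≠ (l : ℤ) - (k : ℤ) := by
  intro hheight
  obtain ⟨m, rfl⟩ := Nat.exists_eq_add_of_le' hn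
  have e₁ := inversions_add_of_sigmaSpec hn h₁
  have e₂ := inversions_add_of_sigmaSpec hn h₂
  apply hne
  simp only [Fin.lt_def] at e₁ e₂
  rw [Prod.mk.injEq, Fin.ext_iff, Fin.ext_iff]
  split_ifs at e₁ e₂ <;> omega
end
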